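/- Let K be a field, n ≥ 2, X the generic n×n matrix over K with entries in S = K[x_{ij}], R = S/(det X), L the cokernel of the R-linear map Rⁿ → Rⁿ given by X̄, and L^∨ the cokernel of the R-linear map given by X̄ᵀ (bars denote reduction modulo det X). Then the annihilator of the R-module Ext¹_R(L, L^∨), viewed as an S-module by restriction of scalars along S → R, is exactly the ideal I_{n−1}(X) ⊆ S generated by the (n−1)×(n−1) minors of X. -/

import Mathlib

open Matrix CategoryTheory

noncomputable section

/-- The generic `n × n` matrix, whose `(i,j)` entry is the indeterminate `x_{ij}` of the
polynomial ring `S = K[x_{ij}]`. -/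
def genericMatrix (K : Type*) [Field K] (n : ℕ) :
    Matrix (Fin n) (Fin n) (MvPolynomial (Fin n × Fin n) K) :=
  Matrix.of fun i j => MvPolynomial.X (i, j)

/-- The generic determinantal hypersurface ring `R = S/(det X)`. -/
abbrev genericDetRing (K : Type*) [Field K] (n : ℕ) :=
  MvPolynomial (Fin n × Fin n) K ⧸ Ideal.span {(genericMatrix K n).det}

/-- Reduction of a matrix over `S` modulo `det X`. -/
def matBar {K : Type*} [Field K] {n : ℕ}
    (A : Matrix (Fin n) (Fin n) (MvPolynomial (Fin n × Fin n) K)) :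
    Matrix (Fin n) (Fin n) (genericDetRing K n) :=
  A.map (Ideal.Quotient.mk _)

/-- The ideal `I_{n-1}(X) ⊆ S` generated by the `(n-1) × (n-1)` minors of the generic matrix. -/
def minorsIdeal (K : Type*) [Field K] (n : ℕ) :
    Ideal (MvPolynomial (Fin n × Fin n) K) :=
  Ideal.span { d | ∃ f g : Fin (n - 1) → Fin n, StrictMono f ∧ StrictMono g ∧
    d = ((genericMatrix K n).submatrix f g).det }

namespace CategoryTheory.ShortComplex
universe v u
variable {R : Type u} [CommRing R]

theorem moduleCat_smul_homology_eq_zero_iff (S : ShortComplex (ModuleCat.{v} R)) (s : R) :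
    (∀ x : S.homology, s • x = 0) ↔ ∀ z : S.X₂, S.g z = 0 → ∃ h : S.X₁, S.f h = s • z := by
  have key : (∀ x : S.homology, s • x = 0) ↔
      ∀ x : S.moduleCatLeftHomologyData.H, s • x = 0 := by
    let e := S.moduleCatHomologyIso.toLinearEquiv
    refine ⟨fun h x => ?_, fun h x => e.injective ?_⟩
    · rw [← e.apply_symm_apply x, ← map_smul, h, map_zero]
    · rw [map_smul, map_zero]; exact h (e x)
  rw [key]
  change (∀ x : LinearMap.ker S.g.hom ⧸ LinearMap.range S.moduleCatToCycles, s • x = 0) ↔ _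
  constructor
  · intro h z hz
    have := h (Submodule.Quotient.mk ⟨z, hz⟩)
    rw [← Submodule.Quotient.mk_smul, Submodule.Quotient.mk_eq_zero] at this
    obtain ⟨y, hy⟩ := this
    exact ⟨y, congrArg Subtype.val hy⟩
  · intro h x
    obtain ⟨⟨z, hz⟩, rfl⟩ := Submodule.Quotient.mk_surjective _ x
    rw [← Submodule.Quotient.mk_smul, Submodule.Quotient.mk_eq_zero]
    obtain ⟨y, hy⟩ := h z hz
    exact ⟨y, Subtype.ext hy⟩
end CategoryTheory.ShortComplex

namespace CategoryTheory.ProjectiveResolution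
universe v u
variable {R : Type u} [CommRing R]

theorem smul_ext_one_eq_zero_iff {L : ModuleCat.{u} R} (P : ProjectiveResolution L)
    (M : ModuleCat.{u} R) (s : R) :
    (∀ x : ((Ext R (ModuleCat.{u} R) 1).obj (Opposite.op L)).obj M, s • x = 0) ↔
      ∀ g : P.complex.X 1 ⟶ M, P.complex.d 2 1 ≫ g = 0 →
        ∃ h : P.complex.X 0 ⟶ M, P.complex.d 1 0 ≫ h = s • g := by
  let D := P.complex.linearYonedaObj R M
  let e := (P.isoExt (R := R) 1 M ≪≫ (ShortComplex.homologyMapIso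
    (D.isoSc' 0 1 2 (by simp) (by simp)))).toLinearEquiv
  have key : (∀ x : ((Ext R (ModuleCat.{u} R) 1).obj (Opposite.op L)).obj M, s • x = 0) ↔
      ∀ x : (D.sc' 0 1 2).homology, s • x = 0 := by
    refine ⟨fun h x => ?_, fun h x => e.injective ?_⟩
    · rw [← e.apply_symm_apply x, ← map_smul, h, map_zero]
    · rw [map_smul, map_zero]; exact h (e x)
  rw [key, ShortComplex.moduleCat_smul_homology_eq_zero_iff]
  rfl

end CategoryTheory.ProjectiveResolution

section
universe u
variable {R : Type u} [CommRing R] {A : Type u} [AddCommGroup A] [Module R A]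

/-- The two-periodic complex `⋯ → A → A → A` with maps alternating between `φ` and `ψ`, ending
in `φ`. -/
abbrev periodicComplex (φ ψ : A →ₗ[R] A)
    (h₁ : Function.Exact ψ φ) (h₂ : Function.Exact φ ψ) : ChainComplex (ModuleCat.{u} R) ℕ :=
  HomologicalComplex.alternatingConst (ModuleCat.of R A)
    (φ := ModuleCat.ofHom ψ) (ψ := ModuleCat.ofHom φ)
    (by ext x; exact h₁.apply_apply_eq_zero x) (by ext x; exact h₂.apply_apply_eq_zero x)
    (fun _ _ => ComplexShape.down_nat_odd_add)

theorem periodicComplex_d_one_zero (φ ψ : A →ₗ[R] A)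
    (h₁ : Function.Exact ψ φ) (h₂ : Function.Exact φ ψ) :
    (periodicComplex φ ψ h₁ h₂).d 1 0 = ModuleCat.ofHom φ := by
  simp
  rfl

/-- The augmentation of the two-periodic complex to the cokernel of `φ`. -/
def periodicAugmentation (φ ψ : A →ₗ[R] A)
    (h₁ : Function.Exact ψ φ) (h₂ : Function.Exact φ ψ) :
    periodicComplex φ ψ h₁ h₂ ⟶
      (ChainComplex.single₀ _).obj (ModuleCat.of R (A ⧸ LinearMap.range φ)) :=
  (ChainComplex.toSingle₀Equiv _ _).symm ⟨ModuleCat.ofHom (LinearMap.range φ).mkQ, by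
    ext x
    rw [periodicComplex_d_one_zero]
    exact (Submodule.Quotient.mk_eq_zero _).2 ⟨x, rfl⟩⟩

theorem periodicAugmentation_f_zero (φ ψ : A →ₗ[R] A)
    (h₁ : Function.Exact ψ φ) (h₂ : Function.Exact φ ψ) :
    (periodicAugmentation φ ψ h₁ h₂).f 0 = ModuleCat.ofHom (LinearMap.range φ).mkQ :=
  ChainComplex.toSingle₀Equiv_symm_apply_f_zero _ _

/-- The two-periodic projective resolution of the cokernel of `φ` attached to an exact pair
of endomorphisms `φ`, `ψ` of a projective module. -/
def periodicResolution [Module.Projective R A] (φ ψ : A →ₗ[R] A)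
    (h₁ : Function.Exact ψ φ) (h₂ : Function.Exact φ ψ) :
    ProjectiveResolution (ModuleCat.of R (A ⧸ LinearMap.range φ)) where
  complex := periodicComplex φ ψ h₁ h₂
  projective _ := inferInstanceAs <| Projective (ModuleCat.of R A)
  π := periodicAugmentation φ ψ h₁ h₂
  quasiIso := ⟨fun m => by
    induction m with
    | zero =>
      rw [ChainComplex.quasiIsoAt₀_iff, ShortComplex.quasiIso_iff_of_zeros' _ rfl rfl rfl]
      constructor
      · rw [ShortComplex.moduleCat_exact_iff_range_eq_ker]
        change LinearMap.range (ModuleCat.Hom.hom ((periodicComplex φ ψ h₁ h₂).d 1 0)) =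
          LinearMap.ker ((periodicAugmentation φ ψ h₁ h₂).f 0).hom
        rw [periodicAugmentation_f_zero]
        rw [periodicComplex_d_one_zero]
        exact (Submodule.ker_mkQ _).symm
      · change Epi ((periodicAugmentation φ ψ h₁ h₂).f 0)
        rw [periodicAugmentation_f_zero]
        exact (ModuleCat.epi_iff_surjective _).2 (Submodule.mkQ_surjective _)
    | succ m _ =>
      rw [quasiIsoAt_iff_exactAt' (hL := ChainComplex.exactAt_succ_single_obj ..),
          HomologicalComplex.exactAt_iff' _ (m + 2) (m + 1) m (by simp) (by simp)]
      rw [ShortComplex.moduleCat_exact_iff_range_eq_ker]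
      by_cases hm : Odd (m + 1)
      · simpa [if_pos (Nat.even_add_one.2 (Nat.not_even_iff_odd.2 hm)),
          if_neg (Nat.not_even_iff_odd.2 hm)] using! h₁.linearMap_ker_eq.symm
      · simpa [if_pos (Nat.not_odd_iff_even.1 hm),
          if_neg (Nat.not_even_iff_odd.2 <| Nat.odd_add_one.2 hm)] using! h₂.linearMap_ker_eq.symm⟩

theorem smul_ext_one_coker_eq_zero_iff [Module.Projective R A] (φ ψ : A →ₗ[R] A)
    (h₁ : Function.Exact ψ φ) (h₂ : Function.Exact φ ψ)
    (M : Type u) [AddCommGroup M] [Module R M] (s : R) :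
    (∀ x : ((Ext R (ModuleCat.{u} R) 1).obj (Opposite.op
        (ModuleCat.of R (A ⧸ LinearMap.range φ)))).obj (ModuleCat.of R M), s • x = 0) ↔
      ∀ g : A →ₗ[R] M, g ∘ₗ ψ = 0 → ∃ h : A →ₗ[R] M, h ∘ₗ φ = s • g := by
  rw [(periodicResolution φ ψ h₁ h₂).smul_ext_one_eq_zero_iff]
  have d21 : (periodicResolution φ ψ h₁ h₂).complex.d 2 1 = ModuleCat.ofHom ψ := by
    simp [periodicResolution]
    rfl
  have d10 : (periodicResolution φ ψ h₁ h₂).complex.d 1 0 = ModuleCat.ofHom φ :=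
    periodicComplex_d_one_zero φ ψ h₁ h₂
  rw [d21, d10]
  constructor
  · intro h g hg
    obtain ⟨k, hk⟩ := h (ModuleCat.ofHom g) (by ext x; exact LinearMap.congr_fun hg x)
    exact ⟨k.hom, congrArg ModuleCat.Hom.hom hk⟩
  · intro h g hg
    obtain ⟨k, hk⟩ := h g.hom (congrArg ModuleCat.Hom.hom hg)
    exact ⟨ModuleCat.ofHom k, by ext x; exact LinearMap.congr_fun hk x⟩
end

section Margins
variable {n : ℕ}

/-- The sum of the entries of `N` in rows `≥ p` and columns `≥ q`. -/
def cornerSum (N : Fin n → Fin n → ℕ) (p q : ℕ) : ℕ :=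
  ∑ i : Fin n, ∑ j : Fin n, if p ≤ (i : ℕ) ∧ q ≤ (j : ℕ) then N i j else 0

theorem sum_cornerSum (N : Fin n → Fin n → ℕ) :
    ∑ p ∈ Finset.range n, ∑ q ∈ Finset.range n, cornerSum N p q =
      ∑ i : Fin n, ∑ j : Fin n, ((i : ℕ) + 1) * (j + 1) * N i j := by
  have h1 : ∀ i : Fin n, ∑ p ∈ Finset.range n, (if p ≤ (i : ℕ) then 1 else 0) = (i : ℕ) + 1 := by
    intro i
    rw [Finset.sum_ite, Finset.sum_const_zero, add_zero, Finset.sum_const, smul_eq_mul, mul_one,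
      ← Finset.card_range ((i : ℕ) + 1)]
    congr 1
    ext p
    simp only [Finset.mem_filter, Finset.mem_range]
    omega
  have h2 : ∀ i j : Fin n, ∑ p ∈ Finset.range n, ∑ q ∈ Finset.range n,
      (if p ≤ (i : ℕ) ∧ q ≤ (j : ℕ) then N i j else 0) = ((i : ℕ) + 1) * (j + 1) * N i j := by
    intro i j
    rw [← h1 i, ← h1 j, Finset.sum_mul_sum, Finset.sum_mul]
    refine Finset.sum_congr rfl fun p _ => ?_
    rw [Finset.sum_mul]
    refine Finset.sum_congr rfl fun q _ => ?_
    by_cases hp : p ≤ (i : ℕ) <;> by_cases hq : q ≤ (j : ℕ) <;> simp [hp, hq]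
  simp only [cornerSum, ← h2]
  simp only [Finset.sum_comm (s := Finset.range n) (t := (Finset.univ : Finset (Fin n)))]

theorem cornerSum_add_cornerSum_succ (N : Fin n → Fin n → ℕ) (i j : Fin n) :
    cornerSum N i j + cornerSum N (i + 1) (j + 1) =
      cornerSum N (i + 1) j + cornerSum N i (j + 1) + N i j := by
  have h : N i j = ∑ a : Fin n, ∑ b : Fin n, if i = a ∧ j = b then N a b else 0 := by
    rw [Finset.sum_eq_single i, Finset.sum_eq_single j] <;> aesop
  rw [h]
  simp only [cornerSum, ← Finset.sum_add_distrib]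
  refine Finset.sum_congr rfl fun a _ => Finset.sum_congr rfl fun b _ => ?_
  simp only [Fin.ext_iff]
  split_ifs <;> omega

theorem cornerSum_eq_zero_of_le (N : Fin n → Fin n → ℕ) {p q : ℕ} (h : n ≤ p ∨ n ≤ q) :
    cornerSum N p q = 0 := by
  refine Finset.sum_eq_zero fun i _ => Finset.sum_eq_zero fun j _ => if_neg ?_
  have := i.2
  have := j.2
  omega

theorem cornerSum_le_of_antichain {N N₀ : Fin n → Fin n → ℕ}
    (hr : ∀ i, ∑ j, N i j = ∑ j, N₀ i j) (hc : ∀ j, ∑ i, N i j = ∑ i, N₀ i j)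
    (ha : ∀ i j i' j', i < i' → j < j' → N₀ i j = 0 ∨ N₀ i' j' = 0) (p q : ℕ) :
    cornerSum N₀ p q ≤ cornerSum N p q := by
  by_cases h0 : cornerSum N₀ p q = 0
  · omega
  let B (M : Fin n → Fin n → ℕ) :=
    ∑ i : Fin n, ∑ j : Fin n, if p ≤ (i : ℕ) ∧ (j : ℕ) < q then M i j else 0
  let C (M : Fin n → Fin n → ℕ) :=
    ∑ i : Fin n, ∑ j : Fin n, if (i : ℕ) < p ∧ q ≤ (j : ℕ) then M i j else 0
  let D (M : Fin n → Fin n → ℕ) :=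
    ∑ i : Fin n, ∑ j : Fin n, if (i : ℕ) < p ∧ (j : ℕ) < q then M i j else 0
  have hAB : ∀ M, cornerSum M p q + B M = ∑ i : Fin n, if p ≤ (i : ℕ) then ∑ j, M i j else 0 := by
    intro M
    simp only [cornerSum, B, ← Finset.sum_add_distrib]
    refine Finset.sum_congr rfl fun i _ => ?_
    split_ifs with hi
    · refine Finset.sum_congr rfl fun j _ => ?_
      split_ifs <;> omega
    · refine Finset.sum_eq_zero fun j _ => ?_
      split_ifs <;> omega
  have hAC : ∀ M, cornerSum M p q + C M = ∑ j : Fin n, if q ≤ (j : ℕ) then ∑ i, M i j else 0 := by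
    intro M
    rw [cornerSum, Finset.sum_comm]
    simp only [C]
    rw [Finset.sum_comm (s := (Finset.univ : Finset (Fin n))) (f := fun (i j : Fin n) =>
      if (i : ℕ) < p ∧ q ≤ (j : ℕ) then M i j else 0)]
    simp only [← Finset.sum_add_distrib]
    refine Finset.sum_congr rfl fun i _ => ?_
    split_ifs with hi
    · refine Finset.sum_congr rfl fun j _ => ?_
      split_ifs <;> omega
    · refine Finset.sum_eq_zero fun j _ => ?_
      split_ifs <;> omega
  have hABCD : ∀ M, cornerSum M p q + B M + C M + D M = ∑ i, ∑ j, M i j := by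
    intro M
    simp only [cornerSum, B, C, D, ← Finset.sum_add_distrib]
    refine Finset.sum_congr rfl fun i _ => Finset.sum_congr rfl fun j _ => ?_
    split_ifs <;> omega
  have hD : D N₀ = 0 := by
    obtain ⟨i', -, hi'⟩ := Finset.exists_ne_zero_of_sum_ne_zero h0
    obtain ⟨j', -, hj'⟩ := Finset.exists_ne_zero_of_sum_ne_zero hi'
    have hpq : p ≤ (i' : ℕ) ∧ q ≤ (j' : ℕ) := by
      by_contra h
      exact hj' (if_neg h)
    rw [if_pos hpq] at hj'
    refine Finset.sum_eq_zero fun i _ => Finset.sum_eq_zero fun j _ => ?_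
    split_ifs with h
    · exact (ha i j i' j' (Fin.lt_def.2 (by omega)) (Fin.lt_def.2 (by omega))).resolve_right hj'
    · rfl
  have e1 := (hAB N).trans ((Finset.sum_congr rfl fun i _ => by rw [hr i]).trans (hAB N₀).symm)
  have e2 := (hAC N).trans ((Finset.sum_congr rfl fun j _ => by rw [hc j]).trans (hAC N₀).symm)
  have e3 := (hABCD N).trans ((Finset.sum_congr rfl fun i _ => hr i).trans (hABCD N₀).symm)
  omega

/-- Among the matrices of natural numbers with given margins, the one supported on an antichain
minimizes the weight `∑ (i + 1) (j + 1) N i j`. -/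
theorem weight_le_of_antichain {N N₀ : Fin n → Fin n → ℕ}
    (hr : ∀ i, ∑ j, N i j = ∑ j, N₀ i j) (hc : ∀ j, ∑ i, N i j = ∑ i, N₀ i j)
    (ha : ∀ i j i' j', i < i' → j < j' → N₀ i j = 0 ∨ N₀ i' j' = 0) :
    ∑ i : Fin n, ∑ j : Fin n, ((i : ℕ) + 1) * (j + 1) * N₀ i j ≤
      ∑ i : Fin n, ∑ j : Fin n, ((i : ℕ) + 1) * (j + 1) * N i j := by
  rw [← sum_cornerSum, ← sum_cornerSum]
  exact Finset.sum_le_sum fun p _ => Finset.sum_le_sum fun q _ =>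
    cornerSum_le_of_antichain hr hc ha p q

theorem eq_of_weight_eq_of_antichain {N N₀ : Fin n → Fin n → ℕ}
    (hr : ∀ i, ∑ j, N i j = ∑ j, N₀ i j) (hc : ∀ j, ∑ i, N i j = ∑ i, N₀ i j)
    (ha : ∀ i j i' j', i < i' → j < j' → N₀ i j = 0 ∨ N₀ i' j' = 0)
    (hw : ∑ i : Fin n, ∑ j : Fin n, ((i : ℕ) + 1) * (j + 1) * N₀ i j =
      ∑ i : Fin n, ∑ j : Fin n, ((i : ℕ) + 1) * (j + 1) * N i j) : N₀ = N := by
  have hle := cornerSum_le_of_antichain hr hc ha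
  rw [← sum_cornerSum, ← sum_cornerSum,
    Finset.sum_eq_sum_iff_of_le fun p _ => Finset.sum_le_sum fun q _ => hle p q] at hw
  have hT : ∀ p q, cornerSum N₀ p q = cornerSum N p q := by
    intro p q
    by_cases h : n ≤ p ∨ n ≤ q
    · rw [cornerSum_eq_zero_of_le _ h, cornerSum_eq_zero_of_le _ h]
    · push Not at h
      exact (Finset.sum_eq_sum_iff_of_le fun q _ => hle p q).1
        (hw p (Finset.mem_range.2 h.1)) q (Finset.mem_range.2 h.2)
  funext i j
  have e1 := cornerSum_add_cornerSum_succ N₀ i j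
  have e2 := cornerSum_add_cornerSum_succ N i j
  simp only [hT] at e1
  omega

end Margins

section Chains
variable {n : ℕ}

/-- `HasChain s k x` says that `x` is the top of a chain of `k + 1` elements of `s` for the strict
componentwise order. -/
def HasChain (s : Set (Fin n × Fin n)) : ℕ → Fin n × Fin n → Prop
  | 0, x => x ∈ s
  | k + 1, x => x ∈ s ∧ ∃ y, HasChain s k y ∧ y.1 < x.1 ∧ y.2 < x.2

theorem HasChain.exists_strictMono {s : Set (Fin n × Fin n)} {k : ℕ} {x : Fin n × Fin n}
    (h : HasChain s k x) : ∃ f g : Fin (k + 1) → Fin n, StrictMono f ∧ StrictMono g ∧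
      (∀ a, (f a, g a) ∈ s) ∧ f (Fin.last k) = x.1 ∧ g (Fin.last k) = x.2 := by
  induction k generalizing x with
  | zero =>
    exact ⟨fun _ => x.1, fun _ => x.2, fun a b h => absurd h (by simp [Fin.lt_def]),
      fun a b h => absurd h (by simp [Fin.lt_def]),
      fun _ => h, rfl, rfl⟩
  | succ k ih =>
    obtain ⟨hx, y, hy, h1, h2⟩ := h
    obtain ⟨f, g, hf, hg, hm, hfl, hgl⟩ := ih hy
    refine ⟨Fin.snoc f x.1, Fin.snoc g x.2, ?_, ?_, ?_, by simp, by simp⟩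
    · rw [Fin.strictMono_iff_lt_succ]
      intro i
      induction i using Fin.lastCases with
      | last => simpa [← hfl] using h1
      | cast i =>
        rw [Fin.succ_castSucc, Fin.snoc_castSucc, Fin.snoc_castSucc]
        exact hf Fin.castSucc_lt_succ
    · rw [Fin.strictMono_iff_lt_succ]
      intro i
      induction i using Fin.lastCases with
      | last => simpa [← hgl] using h2
      | cast i =>
        rw [Fin.succ_castSucc, Fin.snoc_castSucc, Fin.snoc_castSucc]
        exact hg Fin.castSucc_lt_succ
    · intro a
      induction a using Fin.lastCases with
      | last => simpa using hx
      | cast a => simpa using hm a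

/-- A set without a chain of `q + 1` elements is a union of `q` antichains. -/
theorem exists_antichain_coloring {q : ℕ} (s : Set (Fin n × Fin n))
    (hs : ¬ ∃ f g : Fin (q + 1) → Fin n, StrictMono f ∧ StrictMono g ∧ ∀ a, (f a, g a) ∈ s) :
    ∃ c : s → Fin q, ∀ x y : s, x.1.1 < y.1.1 → x.1.2 < y.1.2 → c x ≠ c y := by
  classical
  have hq : ∀ x, ¬ HasChain s q x := fun x hx => by
    obtain ⟨f, g, hf, hg, hm, -⟩ := hx.exists_strictMono
    exact hs ⟨f, g, hf, hg, hm⟩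
  let c (x : Fin n × Fin n) := Nat.findGreatest (fun k => HasChain s k x) q
  have hc : ∀ x ∈ s, HasChain s (c x) x := fun x hx =>
    Nat.findGreatest_spec (P := fun k => HasChain s k x) (Nat.zero_le q) hx
  refine ⟨fun x => ⟨c x, lt_of_le_of_ne (Nat.findGreatest_le q) fun h => hq x (h ▸ hc x x.2)⟩,
    fun x y h1 h2 he => ?_⟩
  have hxy : c x = c y := congrArg Fin.val he
  have hy : HasChain s (c x + 1) y := ⟨y.2, x, hc x x.2, h1, h2⟩
  by_cases hle : c x + 1 ≤ q
  · have : c x + 1 ≤ c y := Nat.le_findGreatest hle hy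
    omega
  · have : c x = q := le_antisymm (Nat.findGreatest_le q) (by omega)
    exact hq x (this ▸ hc x x.2)

end Chains

section Generic
open MvPolynomial
variable (K : Type*) [Field K] {n : ℕ} (q : ℕ)

/-- The ideal of the minors of size `r` of the generic matrix. -/
def genericMinorsIdeal (n r : ℕ) : Ideal (MvPolynomial (Fin n × Fin n) K) :=
  Ideal.span { d | ∃ f g : Fin r → Fin n, StrictMono f ∧ StrictMono g ∧
    d = ((genericMatrix K n).submatrix f g).det }

/-- The substitution of the product of generic matrices of sizes `n × q` and `q × n` for the
generic `n × n` matrix. -/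
def factorHom (n : ℕ) : MvPolynomial (Fin n × Fin n) K →ₐ[K]
    MvPolynomial ((Fin n × Fin q) ⊕ (Fin q × Fin n)) K :=
  aeval fun x => ∑ k : Fin q, X (Sum.inl (x.1, k)) * X (Sum.inr (k, x.2))

/-- The left factor of the generic matrix of rank at most `q`. -/
def leftFactor (n : ℕ) :
    Matrix (Fin n) (Fin q) (MvPolynomial ((Fin n × Fin q) ⊕ (Fin q × Fin n)) K) :=
  Matrix.of fun i k => X (Sum.inl (i, k))

/-- The right factor of the generic matrix of rank at most `q`. -/
def rightFactor (n : ℕ) :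
    Matrix (Fin q) (Fin n) (MvPolynomial ((Fin n × Fin q) ⊕ (Fin q × Fin n)) K) :=
  Matrix.of fun k j => X (Sum.inr (k, j))

theorem genericMatrix_map_factorHom (n : ℕ) :
    (genericMatrix K n).map (factorHom K q n) = leftFactor K q n * rightFactor K q n := by
  ext1 i j
  simp [genericMatrix, factorHom, Matrix.mul_apply, leftFactor, rightFactor]

theorem det_mul_eq_zero_of_succ {A : Type*} [CommRing A] {q : ℕ}
    (B : Matrix (Fin (q + 1)) (Fin q) A) (C : Matrix (Fin q) (Fin (q + 1)) A) :
    (B * C).det = 0 := by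
  have h : B * C = (Matrix.of fun i => (Fin.snoc (B i) 0 : Fin (q + 1) → A)) *
      (Matrix.of (Fin.snoc (α := fun _ => Fin (q + 1) → A) C 0)) := by
    ext i j
    simp only [Matrix.mul_apply, Fin.sum_univ_castSucc, Matrix.of_apply]
    have h (x : Fin q) : Fin.snoc (α := fun _ => Fin (q + 1) → A) C 0 x.castSucc j = C x j :=
      congrFun (Fin.snoc_castSucc (α := fun _ => Fin (q + 1) → A) _ _ x) j
    simp [h]
  rw [h, Matrix.det_mul, Matrix.det_eq_zero_of_column_eq_zero (Fin.last q) (by simp), zero_mul]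

theorem factorHom_eq_zero_of_mem {s : MvPolynomial (Fin n × Fin n) K}
    (hs : s ∈ genericMinorsIdeal K n (q + 1)) : factorHom K q n s = 0 := by
  suffices genericMinorsIdeal K n (q + 1) ≤ RingHom.ker (factorHom K q n) from this hs
  rw [genericMinorsIdeal, Ideal.span_le]
  rintro _ ⟨f, g, -, -, rfl⟩
  change factorHom K q n _ = 0
  rw [AlgHom.map_det, AlgHom.mapMatrix_apply, ← Matrix.submatrix_map,
    genericMatrix_map_factorHom, Matrix.submatrix_mul _ _ f id g Function.bijective_id]
  exact det_mul_eq_zero_of_succ _ _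

/-- The weight `∑ (i + 1) (j + 1) m i j` of an exponent `m`. -/
def expWeight (m : Fin n × Fin n →₀ ℕ) : ℕ :=
  ∑ i : Fin n, ∑ j : Fin n, ((i : ℕ) + 1) * (j + 1) * m (i, j)

theorem expWeight_add (m m' : Fin n × Fin n →₀ ℕ) :
    expWeight (m + m') = expWeight m + expWeight m' := by
  simp [expWeight, mul_add, Finset.sum_add_distrib]

theorem expWeight_single (x : Fin n × Fin n) :
    expWeight (Finsupp.single x 1) = ((x.1 : ℕ) + 1) * (x.2 + 1) := by
  rw [expWeight, Finset.sum_eq_single x.1, Finset.sum_eq_single x.2]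
  · simp
  · intro j _ hj
    rw [Finsupp.single_eq_of_ne (fun h => hj (congrArg Prod.snd h)), mul_zero]
  · simp
  · intro i _ hi
    refine Finset.sum_eq_zero fun j _ => ?_
    rw [Finsupp.single_eq_of_ne (fun h => hi (congrArg Prod.fst h)), mul_zero]
  · simp

theorem expWeight_sum {ι : Type*} (t : Finset ι) (m : ι → Fin n × Fin n →₀ ℕ) :
    expWeight (∑ a ∈ t, m a) = ∑ a ∈ t, expWeight (m a) := by
  classical
  induction t using Finset.induction_on with
  | empty => simp [expWeight]
  | insert a t ha ih => rw [Finset.sum_insert ha, Finset.sum_insert ha, expWeight_add, ih]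

/-- The exponents whose support contains no chain of `q + 1` positions. -/
def chainFree (n q : ℕ) : Set (Fin n × Fin n →₀ ℕ) :=
  { m | ¬ ∃ f g : Fin (q + 1) → Fin n, StrictMono f ∧ StrictMono g ∧
    ∀ a, (f a, g a) ∈ (m.support : Set (Fin n × Fin n)) }

variable {q} in
theorem sum_perm_lt {f g : Fin (q + 1) → Fin n} (hf : StrictMono f) (hg : StrictMono g)
    {σ : Equiv.Perm (Fin (q + 1))} (hσ : σ ≠ 1) :
    ∑ a, ((f (σ a) : ℕ) + 1) * (g a + 1) < ∑ a, ((f a : ℕ) + 1) * (g a + 1) := by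
  have hf' : StrictMono fun a => (f a : ℕ) + 1 := fun a b h => Nat.succ_lt_succ (hf h)
  have hg' : StrictMono fun a => (g a : ℕ) + 1 := fun a b h => Nat.succ_lt_succ (hg h)
  refine (Monovary.sum_comp_perm_mul_lt_sum_mul_iff (f := fun a => (f a : ℕ) + 1)
    (g := fun a => (g a : ℕ) + 1) (hf'.monotone.monovary hg'.monotone)).2 fun hm => hσ ?_
  have hmono : StrictMono σ := by
    refine Monotone.strictMono_of_injective (fun a b hab => ?_) σ.injective
    rcases hab.eq_or_lt with rfl | hab
    · exact le_rfl
    · exact hf'.le_iff_le.1 (hm (hg' hab))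
  ext a
  exact congrArg Fin.val (congrFun (StrictMono.range_inj hmono strictMono_id |>.1 (by simp)) a)

theorem monomial_mem_sup (m : Fin n × Fin n →₀ ℕ) :
    monomial m (1 : K) ∈ (genericMinorsIdeal K n (q + 1)).restrictScalars K ⊔
      restrictSupport K (chainFree n q) := by
  induction hw : expWeight m using Nat.strong_induction_on generalizing m with
  | _ w ih =>
  subst hw
  by_cases hm : m ∈ chainFree n q
  · refine Submodule.mem_sup_right ?_
    rw [mem_restrictSupport_iff]
    exact (Finset.coe_subset.2 support_monomial_subset).trans (by simpa using hm)
  obtain ⟨f, g, hf, hg, hfg⟩ := not_not.1 hm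
  let d (σ : Equiv.Perm (Fin (q + 1))) : Fin n × Fin n →₀ ℕ :=
    ∑ a, Finsupp.single (f (σ a), g a) 1
  have hd : d 1 ≤ m := by
    intro x
    rw [Finsupp.finsetSum_apply]
    by_cases hx : ∃ a, (f a, g a) = x
    · obtain ⟨a, rfl⟩ := hx
      rw [Finset.sum_eq_single a]
      · have := Finsupp.mem_support_iff.1 (Finset.mem_coe.1 (hfg a))
        simp
        omega
      · intro b _ hb
        refine Finsupp.single_eq_of_ne fun h => hb (hf.injective ?_)
        exact (congrArg Prod.fst h).symm
      · simp
    · rw [Finset.sum_eq_zero]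
      · exact Nat.zero_le _
      · intro a _
        exact Finsupp.single_eq_of_ne fun h => hx ⟨a, h.symm⟩
  obtain ⟨m₀, rfl⟩ := exists_add_of_le hd
  have hmon : ∀ σ, monomial (d σ + m₀) (1 : K) =
      monomial m₀ 1 * ∏ a, (genericMatrix K n).submatrix f g (σ a) a := by
    intro σ
    have : ∏ a, (genericMatrix K n).submatrix f g (σ a) a = monomial (d σ) (1 : K) := by
      rw [monomial_sum_one]
      rfl
    rw [this, monomial_mul, one_mul, add_comm]
  have hdet := Matrix.det_apply' ((genericMatrix K n).submatrix f g)
  rw [← Finset.add_sum_erase _ _ (Finset.mem_univ 1)] at hdet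
  have key : monomial (d 1 + m₀) (1 : K) =
      monomial m₀ 1 * ((genericMatrix K n).submatrix f g).det -
        ∑ σ ∈ Finset.univ.erase (1 : Equiv.Perm (Fin (q + 1))),
          ((Equiv.Perm.sign σ : ℤ) : K) • monomial (d σ + m₀) (1 : K) := by
    rw [hdet, mul_add, Finset.mul_sum, hmon 1]
    simp only [hmon, smul_eq_C_mul]
    simp [mul_left_comm]
  rw [key]
  refine Submodule.sub_mem _ (Submodule.mem_sup_left ?_)
    (Submodule.sum_mem _ fun σ hσ => Submodule.smul_mem _ _ ?_)
  · exact Ideal.mul_mem_left _ _ (Ideal.subset_span ⟨f, g, hf, hg, rfl⟩)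
  · refine ih _ ?_ _ rfl
    simp only [expWeight_add, d, expWeight_sum, expWeight_single]
    simpa using sum_perm_lt hf hg (Finset.ne_of_mem_erase hσ)

end Generic

section Coloring
open MvPolynomial
variable {n q : ℕ}

/-- The exponent of the monomial in the entries of the two factors obtained from a colouring of the
factors of a monomial in the entries of the generic matrix. -/
def colorExponent {m : Fin n × Fin n → ℕ} (κ : (Σ x, Fin (m x)) → Fin q) :
    (Fin n × Fin q) ⊕ (Fin q × Fin n) →₀ ℕ :=
  ∑ t, (Finsupp.single (Sum.inl (t.1.1, κ t)) 1 + Finsupp.single (Sum.inr (κ t, t.1.2)) 1)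

/-- The number of factors `x_{ij}` of colour `k`. -/
def colorCount {m : Fin n × Fin n → ℕ} (κ : (Σ x, Fin (m x)) → Fin q) (k : Fin q)
    (i j : Fin n) : ℕ :=
  ∑ t, if t.1 = (i, j) ∧ κ t = k then 1 else 0

theorem sum_colorCount_right {m : Fin n × Fin n → ℕ} (κ : (Σ x, Fin (m x)) → Fin q) (k : Fin q)
    (i : Fin n) : ∑ j, colorCount κ k i j = colorExponent κ (Sum.inl (i, k)) := by
  simp only [colorCount, colorExponent, Finsupp.finsetSum_apply]
  rw [Finset.sum_comm]
  refine Finset.sum_congr rfl fun t _ => ?_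
  rw [Finset.sum_eq_single t.1.2 (by aesop) (by simp)]
  simp [Finsupp.single_apply, Prod.ext_iff]

theorem sum_colorCount_left {m : Fin n × Fin n → ℕ} (κ : (Σ x, Fin (m x)) → Fin q) (k : Fin q)
    (j : Fin n) : ∑ i, colorCount κ k i j = colorExponent κ (Sum.inr (k, j)) := by
  simp only [colorCount, colorExponent, Finsupp.finsetSum_apply]
  rw [Finset.sum_comm]
  refine Finset.sum_congr rfl fun t _ => ?_
  rw [Finset.sum_eq_single t.1.1 (by aesop) (by simp)]
  simp [Finsupp.single_apply, Prod.ext_iff, and_comm]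

theorem sum_colorCount {m : Fin n × Fin n → ℕ} (κ : (Σ x, Fin (m x)) → Fin q) (i j : Fin n) :
    ∑ k, colorCount κ k i j = m (i, j) := by
  simp only [colorCount]
  rw [Finset.sum_comm, Fintype.sum_sigma, Finset.sum_eq_single (i, j)]
  · simp
  · intro x _ hx
    simp [hx]
  · simp

theorem exists_of_colorCount_ne_zero {m : Fin n × Fin n → ℕ} {κ : (Σ x, Fin (m x)) → Fin q}
    {k : Fin q} {i j : Fin n} (h : colorCount κ k i j ≠ 0) : ∃ t, t.1 = (i, j) ∧ κ t = k := by
  obtain ⟨t, -, ht⟩ := Finset.exists_ne_zero_of_sum_ne_zero h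
  exact ⟨t, by simpa using ht⟩

theorem colorCount_ne_zero {m : Fin n × Fin n → ℕ} (κ : (Σ x, Fin (m x)) → Fin q)
    (t : Σ x, Fin (m x)) : colorCount κ (κ t) t.1.1 t.1.2 ≠ 0 := by
  intro h
  simpa using (Finset.sum_eq_zero_iff.1 h) t (Finset.mem_univ _)

theorem sum_weight_colorCount {m : Fin n × Fin n →₀ ℕ} (κ : (Σ x, Fin (m x)) → Fin q) :
    ∑ k, ∑ i : Fin n, ∑ j : Fin n, ((i : ℕ) + 1) * (j + 1) * colorCount κ k i j = expWeight m := by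
  rw [Finset.sum_comm, expWeight]
  refine Finset.sum_congr rfl fun i _ => ?_
  rw [Finset.sum_comm]
  refine Finset.sum_congr rfl fun j _ => ?_
  rw [← Finset.mul_sum, sum_colorCount]

theorem colorCount_eq_of_colorExponent_eq {m m₀ : Fin n × Fin n →₀ ℕ}
    {κ₀ : (Σ x, Fin (m₀ x)) → Fin q} {κ : (Σ x, Fin (m x)) → Fin q}
    (h₀ : ∀ t t', t.1.1 < t'.1.1 → t.1.2 < t'.1.2 → κ₀ t ≠ κ₀ t')
    (h : colorExponent κ = colorExponent κ₀) (hw : expWeight m ≤ expWeight m₀) (k : Fin q) :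
    colorCount κ₀ k = colorCount κ k := by
  have hr : ∀ k i, ∑ j, colorCount κ k i j = ∑ j, colorCount κ₀ k i j := fun k i => by
    rw [sum_colorCount_right, sum_colorCount_right, h]
  have hc : ∀ k j, ∑ i, colorCount κ k i j = ∑ i, colorCount κ₀ k i j := fun k j => by
    rw [sum_colorCount_left, sum_colorCount_left, h]
  have ha : ∀ k i j i' j', i < i' → j < j' →
      colorCount κ₀ k i j = 0 ∨ colorCount κ₀ k i' j' = 0 := by
    intro k i j i' j' hi hj
    by_contra! hne
    obtain ⟨t, ht, hk⟩ := exists_of_colorCount_ne_zero hne.1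
    obtain ⟨t', ht', hk'⟩ := exists_of_colorCount_ne_zero hne.2
    exact h₀ t t' (by rwa [ht, ht']) (by rwa [ht, ht']) (hk.trans hk'.symm)
  have hle := fun k => weight_le_of_antichain (hr k) (hc k) (ha k)
  refine eq_of_weight_eq_of_antichain (hr k) (hc k) (ha k) ?_
  refine (Finset.sum_eq_sum_iff_of_le fun k _ => hle k).1 (le_antisymm ?_ ?_) k (Finset.mem_univ k)
  · exact Finset.sum_le_sum fun k _ => hle k
  · rwa [sum_weight_colorCount, sum_weight_colorCount]

variable (K : Type*) [Field K]

theorem factorHom_monomial (m : Fin n × Fin n →₀ ℕ) :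
    factorHom K q n (monomial m 1) =
      ∑ κ : (Σ x, Fin (m x)) → Fin q, monomial (colorExponent κ) 1 := by
  have h : monomial m (1 : K) = ∏ t : Σ x, Fin (m x), X t.1 := by
    rw [Fintype.prod_sigma, monomial_eq, C_1, one_mul, Finsupp.prod_fintype _ _ (by simp)]
    simp
  rw [h, map_prod]
  simp only [factorHom, aeval_X]
  rw [Finset.prod_univ_sum, Fintype.piFinset_univ]
  refine Finset.sum_congr rfl fun κ _ => ?_
  rw [colorExponent, monomial_sum_one]
  refine Finset.prod_congr rfl fun t _ => ?_
  rw [X, X, monomial_mul, one_mul]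

theorem eq_zero_of_factorHom_eq_zero {s : MvPolynomial (Fin n × Fin n) K}
    (hs : s ∈ restrictSupport K (chainFree n q)) (h : factorHom K q n s = 0) : s = 0 := by
  by_contra hne
  obtain ⟨m₀, hm₀, hmax⟩ := s.support.exists_max_image expWeight (support_nonempty.2 hne)
  obtain ⟨c, hc⟩ := exists_antichain_coloring _ ((mem_restrictSupport_iff K).1 hs hm₀)
  have hmem (t : Σ x, Fin (m₀ x)) : t.1 ∈ (m₀.support : Set (Fin n × Fin n)) :=
    Finsupp.mem_support_iff.2 (t.2.pos.ne')
  let κ₀ (t : Σ x, Fin (m₀ x)) : Fin q := c ⟨t.1, hmem t⟩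
  have h₀ : ∀ t t', t.1.1 < t'.1.1 → t.1.2 < t'.1.2 → κ₀ t ≠ κ₀ t' := fun t t' hi hj =>
    hc ⟨t.1, hmem t⟩ ⟨t'.1, hmem t'⟩ hi hj
  have hcount : ∀ m ∈ s.support, ∀ κ : (Σ x, Fin (m x)) → Fin q,
      colorExponent κ = colorExponent κ₀ → ∀ k, colorCount κ₀ k = colorCount κ k :=
    fun m hm κ hκ => colorCount_eq_of_colorExponent_eq h₀ hκ (hmax m hm)
  have hcoeff : coeff (colorExponent κ₀) (factorHom K q n s) = coeff m₀ s := by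
    conv_lhs => rw [s.as_sum]
    rw [map_sum, coeff_sum, Finset.sum_eq_single m₀]
    · rw [← mul_one (coeff m₀ s), ← smul_eq_mul, ← smul_monomial, map_smul, factorHom_monomial,
        coeff_smul, coeff_sum, Finset.sum_eq_single κ₀]
      · simp
      · intro κ _ hκ
        rw [coeff_monomial, if_neg]
        intro he
        refine hκ (funext fun t => ?_)
        have := colorCount_ne_zero κ t
        rw [← hcount m₀ hm₀ κ he] at this
        obtain ⟨t', ht, hk⟩ := exists_of_colorCount_ne_zero this
        rw [← hk]
        exact congrArg c (Subtype.ext ht)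
      · simp
    · intro m hm hmne
      rw [← mul_one (coeff m s), ← smul_eq_mul, ← smul_monomial, map_smul, factorHom_monomial,
        coeff_smul, coeff_sum, Finset.sum_eq_zero, smul_zero]
      intro κ _
      rw [coeff_monomial, if_neg]
      intro he
      refine hmne (Finsupp.ext fun x => ?_)
      rw [← sum_colorCount κ x.1 x.2, ← sum_colorCount κ₀ x.1 x.2]
      simp only [hcount m hm κ he]
    · intro hm
      exact absurd hm₀ hm
  rw [h, coeff_zero] at hcoeff
  exact mem_support_iff.1 hm₀ hcoeff.symm

/-- The kernel of the substitution of a product of generic matrices with inner size `q` is the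
ideal of minors of size `q + 1`. -/
theorem factorHom_eq_zero_iff {s : MvPolynomial (Fin n × Fin n) K} :
    factorHom K q n s = 0 ↔ s ∈ genericMinorsIdeal K n (q + 1) := by
  refine ⟨fun h => ?_, factorHom_eq_zero_of_mem K q⟩
  have hs : s ∈ (genericMinorsIdeal K n (q + 1)).restrictScalars K ⊔
      restrictSupport K (chainFree n q) := by
    rw [s.as_sum]
    refine Submodule.sum_mem _ fun m _ => ?_
    rw [← mul_one (coeff m s), ← smul_eq_mul, ← smul_monomial]
    exact Submodule.smul_mem _ _ (monomial_mem_sup K q m)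
  obtain ⟨a, ha, b, hb, rfl⟩ := Submodule.mem_sup.1 hs
  rw [map_add, factorHom_eq_zero_of_mem K q ha, zero_add] at h
  rw [eq_zero_of_factorHom_eq_zero K hb h, add_zero]
  exact ha

end Coloring

section Adjugate
open Polynomial
variable {ι A : Type*} [Fintype ι] [DecidableEq ι] [CommRing A]

/-- The derivative of the relation `adj M * M = det M` in the direction of a matrix unit. -/
theorem Matrix.exists_adjugate_apply_smul_one_eq (M : Matrix ι ι A) (i j : ι) :
    ∃ D : Matrix ι ι A,
      M.adjugate j i • (1 : Matrix ι ι A) = D * M + M.adjugate * Matrix.single i j 1 := by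
  let N : Matrix ι ι A[X] := M.map (C : A →+* A[X]) + (X : A[X]) • Matrix.single i j 1
  have hN₀ : N.map (evalRingHom 0) = M := by
    ext a b
    simp [N, Matrix.single_apply, apply_ite]
  have hadj : ∀ a b, (N.adjugate a b).coeff 0 = M.adjugate a b := by
    intro a b
    have := congrArg (fun Q => Matrix.adjugate Q a b) hN₀
    simp only [← RingHom.mapMatrix_apply, ← RingHom.map_adjugate] at this
    simpa [coeff_zero_eq_eval_zero] using this
  have hupd : N =
      (M.map (C : A →+* A[X])).updateRow i ((M.map (C : A →+* A[X])) i + (X : A[X]) • Pi.single j 1) := by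
    ext1 a b
    by_cases ha : a = i
    · subst ha
      by_cases hb : b = j
      · subst hb; simp [N]
      · simp [N, hb, Ne.symm hb]
    · simp [N, ha, Ne.symm ha]
  have hdet : N.det = C M.det + X * C (M.adjugate j i) := by
    rw [hupd, Matrix.det_updateRow_add, Matrix.det_updateRow_smul, Matrix.updateRow_eq_self,
      ← Matrix.adjugate_apply, ← RingHom.mapMatrix_apply, ← RingHom.map_det,
      ← RingHom.map_adjugate]
    rfl
  refine ⟨N.adjugate.map fun p => p.coeff 1, ?_⟩
  ext a b
  have h := congrArg (fun Q => (Q a b).coeff 1) N.adjugate_mul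
  have hN₀' : ∀ x y, (N x y).coeff 0 = M x y := fun x y => by
    rw [coeff_zero_eq_eval_zero]
    exact congrArg (fun Q => Q x y) hN₀
  have hN₁ : ∀ x y, (N x y).coeff 1 = Matrix.single i j (1 : A) x y := fun x y => by
    simp [N, Matrix.single_apply, apply_ite]
    split_ifs <;> simp
  simp only [hdet, Matrix.mul_apply, Matrix.smul_apply, smul_eq_mul, finsetSum_coeff,
    mul_coeff_one, hadj, hN₀', hN₁, Finset.sum_add_distrib] at h
  rcases eq_or_ne a b with rfl | hab
  · simp [Matrix.mul_apply, coeff_one] at h ⊢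
    linear_combination -h
  · simp [Matrix.mul_apply, hab] at h ⊢
    linear_combination -h

theorem Matrix.det_dvd_adjugate_mul_sub (M : Matrix ι ι A) (i j k l : ι) :
    M.det ∣ M.adjugate j i * M.adjugate k l - M.adjugate k i * M.adjugate j l := by
  obtain ⟨D, hD⟩ := M.exists_adjugate_apply_smul_one_eq i j
  refine ⟨D k l, ?_⟩
  have h := congrArg (fun Q => (Q * M.adjugate) k l) hD
  simp only [Matrix.add_mul, Matrix.mul_assoc, Matrix.mul_adjugate, Matrix.smul_mul,
    Matrix.one_mul, Matrix.mul_smul, Matrix.mul_one] at h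
  simp [Matrix.mul_apply, Matrix.single_apply, ite_and] at h
  rw [h, add_sub_cancel_right]

end Adjugate

section Hypersurface
universe u
variable {S : Type u} [CommRing S] {ι : Type*} [Fintype ι] [DecidableEq ι]

theorem exact_mulVecLin_of_mul_eq_smul_one [IsDomain S] {f : S} (hf : f ≠ 0) {M N : Matrix ι ι S}
    (hMN : M * N = f • 1) (hNM : N * M = f • 1) :
    Function.Exact (Matrix.mulVecLin (N.map (Ideal.Quotient.mk (Ideal.span {f}))))
      (Matrix.mulVecLin (M.map (Ideal.Quotient.mk (Ideal.span {f})))) := by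
  have hf0 : Ideal.Quotient.mk (Ideal.span {f}) f = 0 :=
    Ideal.Quotient.eq_zero_iff_mem.2 (Ideal.mem_span_singleton_self f)
  have hmap (Q : Matrix ι ι S) (v : ι → S) :
      Q.map (Ideal.Quotient.mk (Ideal.span {f})) *ᵥ (Ideal.Quotient.mk (Ideal.span {f}) ∘ v) =
        Ideal.Quotient.mk (Ideal.span {f}) ∘ (Q *ᵥ v) := by
    ext i
    exact ((Ideal.Quotient.mk _).map_mulVec Q v i).symm
  intro v
  obtain ⟨v, rfl⟩ : ∃ v', Ideal.Quotient.mk (Ideal.span {f}) ∘ v' = v :=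
    Ideal.Quotient.mk_surjective.comp_left v
  simp only [Matrix.mulVecLin_apply, Set.mem_range]
  constructor
  · intro hv
    rw [hmap] at hv
    have : ∀ i, ∃ w, (M *ᵥ v) i = f * w := fun i =>
      Ideal.mem_span_singleton.1 (Ideal.Quotient.eq_zero_iff_mem.1 (congrFun hv i))
    choose w hw using this
    refine ⟨Ideal.Quotient.mk _ ∘ w, ?_⟩
    rw [hmap]
    congr 1
    have h : f • v = f • (N *ᵥ w) := by
      rw [← Matrix.mulVec_smul, show f • w = M *ᵥ v from (funext hw).symm, Matrix.mulVec_mulVec,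
        hNM, Matrix.smul_mulVec, Matrix.one_mulVec]
    exact (smul_right_injective _ hf h).symm
  · rintro ⟨w, hw⟩
    rw [← hw, Matrix.mulVec_mulVec, ← Matrix.map_mul, hMN]
    ext i
    simp [Matrix.mulVec, dotProduct, Matrix.one_apply, hf0, apply_ite]

/-- The entries of the adjugate of `M` annihilate the first extensions of the cokernel of `M`. -/
theorem exists_comp_eq_adjugate_smul {R : Type*} [CommRing R] {P : Type*} [AddCommGroup P]
    [Module R P] (π : S →+* R) (M : Matrix ι ι S) (i j : ι) (g : (ι → R) →ₗ[R] P)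
    (hg : g ∘ₗ Matrix.mulVecLin (M.adjugate.map π) = 0) :
    ∃ h : (ι → R) →ₗ[R] P, h ∘ₗ Matrix.mulVecLin (M.map π) = π (M.adjugate j i) • g := by
  obtain ⟨D, hD⟩ := (M.map π).exists_adjugate_apply_smul_one_eq i j
  have hadj : (M.map π).adjugate = M.adjugate.map π := (π.map_adjugate M).symm
  refine ⟨g ∘ₗ Matrix.mulVecLin D, ?_⟩
  ext1 a
  ext1
  rw [hadj] at hD
  have h := congrArg (fun Q => g (Q *ᵥ Pi.single a 1)) hD
  have h' := LinearMap.congr_fun hg (Matrix.single i j 1 *ᵥ Pi.single a 1)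
  simp only [LinearMap.comp_apply, Matrix.mulVecLin_apply, LinearMap.zero_apply,
    Matrix.mulVec_mulVec] at h'
  simp only [Matrix.add_mulVec, map_add, h', add_zero, Matrix.smul_mulVec, Matrix.one_mulVec,
    map_smul] at h
  simp only [LinearMap.comp_apply, LinearMap.smul_apply, Matrix.mulVecLin_apply,
    LinearMap.coe_single, Matrix.mulVec_mulVec, ← h, Matrix.map_apply]

theorem map_eq_zero_of_forall_exists_comp_eq_smul [IsDomain S] {M : Matrix ι ι S}
    (hM : M.det ≠ 0) {s : S}
    (hs : ∀ g : (ι → S ⧸ Ideal.span {M.det}) →ₗ[S ⧸ Ideal.span {M.det}]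
        (ι → S ⧸ Ideal.span {M.det}) ⧸
          LinearMap.range (Matrix.mulVecLin (Mᵀ.map (Ideal.Quotient.mk (Ideal.span {M.det})))),
      g ∘ₗ Matrix.mulVecLin (M.adjugate.map (Ideal.Quotient.mk (Ideal.span {M.det}))) = 0 →
      ∃ h : (ι → S ⧸ Ideal.span {M.det}) →ₗ[S ⧸ Ideal.span {M.det}] _,
        h ∘ₗ Matrix.mulVecLin (M.map (Ideal.Quotient.mk (Ideal.span {M.det}))) =
          Ideal.Quotient.mk (Ideal.span {M.det}) s • g)
    {F : Type*} [Field F] (σ : S →+* F) {w w' : ι → F}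
    (hw : M.map σ *ᵥ w = 0) (hw' : M.map σ *ᵥ w' = 0) {k l : ι}
    (hkl : w k * w' l - w l * w' k ≠ 0) : σ s = 0 := by
  set π := Ideal.Quotient.mk (Ideal.span {M.det})
  let A : Matrix ι ι (S ⧸ Ideal.span {M.det}) := Matrix.single k l 1 - Matrix.single l k 1
  have hdet : σ M.det = 0 := by
    rw [RingHom.map_det]
    refine Matrix.exists_mulVec_eq_zero_iff.1 ⟨w, ?_, hw⟩
    rintro rfl
    simp at hkl
  let ρ : S ⧸ Ideal.span {M.det} →+* F := Ideal.Quotient.lift _ σ fun a ha => by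
    obtain ⟨b, rfl⟩ := Ideal.mem_span_singleton.1 ha
    rw [map_mul, hdet, zero_mul]
  have hρ : ∀ a, ρ (π a) = σ a := fun a => Ideal.Quotient.lift_mk _ _ _
  have hex := exact_mulVecLin_of_mul_eq_smul_one (f := M.det) hM (M := M.adjugateᵀ) (N := Mᵀ)
    (by rw [← Matrix.transpose_mul, Matrix.mul_adjugate, Matrix.transpose_smul,
      Matrix.transpose_one])
    (by rw [← Matrix.transpose_mul, Matrix.adjugate_mul, Matrix.transpose_smul,
      Matrix.transpose_one])
  have hA : M.adjugateᵀ.map π * (A * M.adjugate.map π) = 0 := by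
    ext a b
    have h : π (M.adjugate k a * M.adjugate l b - M.adjugate l a * M.adjugate k b) = 0 :=
      Ideal.Quotient.eq_zero_iff_mem.2
        (Ideal.mem_span_singleton.2 (M.det_dvd_adjugate_mul_sub a k l b))
    rw [map_sub, map_mul, map_mul] at h
    simp [A, Matrix.mul_apply, Matrix.sub_mul, Matrix.single_apply, ite_and, mul_sub, h]
  obtain ⟨h, hh⟩ := hs ((LinearMap.range (Matrix.mulVecLin (Mᵀ.map π))).mkQ ∘ₗ
    Matrix.mulVecLin A) (by
      refine LinearMap.ext fun v => (Submodule.Quotient.mk_eq_zero _).2 ?_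
      refine (hex _).1 ?_
      simp only [Matrix.mulVecLin_apply, Matrix.mulVec_mulVec]
      rw [hA, Matrix.zero_mulVec])
  obtain ⟨H, rfl⟩ := Module.projective_lifting_property
    (LinearMap.range (Matrix.mulVecLin (Mᵀ.map π))).mkQ h (Submodule.mkQ_surjective _)
  have hcol : ∀ b, ∃ c : ι → S ⧸ Ideal.span {M.det},
      Mᵀ.map π *ᵥ c = H (M.map π *ᵥ Pi.single b 1) - π s • (A *ᵥ Pi.single b 1) := by
    intro b
    have := LinearMap.congr_fun hh (Pi.single b 1)
    exact (Submodule.Quotient.eq _).1 this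
  choose c hc using hcol
  have hmat : Mᵀ.map π * (Matrix.of c)ᵀ = LinearMap.toMatrix' H * M.map π - π s • A := by
    ext a b
    change (Mᵀ.map π *ᵥ c b) a =
      (LinearMap.toMatrix' H *ᵥ (M.map π).col b) a - (π s • A) a b
    rw [hc, LinearMap.toMatrix'_mulVec]
    simp
  have hF := congrArg (fun Q => w ⬝ᵥ (Q.map ρ *ᵥ w')) hmat
  have hπρ (Q : Matrix ι ι S) : (Q.map π).map ρ = Q.map σ := by
    ext a b
    exact hρ _
  have hAρ : (π s • A).map ρ = σ s • (Matrix.single k l 1 - Matrix.single l k 1) := by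
    ext a b
    simp only [A, Matrix.map_apply, Matrix.smul_apply, Matrix.sub_apply, smul_eq_mul, map_mul, hρ,
      map_sub, Matrix.single_apply, apply_ite ρ, map_one, map_zero]
  rw [Matrix.map_sub _ (map_sub ρ), Matrix.map_mul, Matrix.map_mul, hπρ, hπρ, hAρ,
    Matrix.sub_mulVec, ← Matrix.mulVec_mulVec, ← Matrix.mulVec_mulVec, hw', Matrix.mulVec_zero,
    zero_sub, dotProduct_neg, Matrix.dotProduct_mulVec, Matrix.transpose_map,
    Matrix.vecMul_transpose, hw, zero_dotProduct, zero_eq_neg, Matrix.smul_mulVec,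
    dotProduct_smul, smul_eq_mul] at hF
  refine (mul_eq_zero.1 hF).resolve_right ?_
  have hsingle (k l : ι) : w ⬝ᵥ Matrix.single k l 1 *ᵥ w' = w k * w' l := by
    simp [dotProduct, Matrix.mulVec, Matrix.single_apply, ite_and]
  rwa [Matrix.sub_mulVec, dotProduct_sub, hsingle, hsingle]

theorem exists_mulVec_eq_zero_and_ne {F : Type*} [Field F] {q : ℕ}
    (Z : Matrix (Fin q) (Fin (q + 2)) F) : ∃ w w' : Fin (q + 2) → F, Z *ᵥ w = 0 ∧ Z *ᵥ w' = 0 ∧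
      ∃ k l, w k * w' l - w l * w' k ≠ 0 := by
  have hrank : 1 < Module.finrank F (LinearMap.ker Z.mulVecLin) := by
    have h₁ := LinearMap.finrank_range_add_finrank_ker Z.mulVecLin
    have h₂ := (LinearMap.range Z.mulVecLin).finrank_le
    simp only [Module.finrank_fin_fun] at h₁ h₂
    omega
  have : Nontrivial (LinearMap.ker Z.mulVecLin) :=
    Module.nontrivial_of_finrank_pos (R := F) (by omega)
  obtain ⟨x, hx⟩ := exists_ne (0 : LinearMap.ker Z.mulVecLin)
  obtain ⟨y, hxy⟩ := exists_linearIndependent_pair_of_one_lt_finrank hrank hx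
  refine ⟨x, y, x.2, y.2, ?_⟩
  by_contra! h
  obtain ⟨k, hk⟩ : ∃ k, x.1 k ≠ 0 := by
    by_contra! h0
    exact hx (Subtype.ext (funext h0))
  refine hk ((LinearIndependent.pair_iff.1 hxy (-y.1 k) (x.1 k) ?_).2)
  refine Subtype.ext (funext fun l => ?_)
  have := h k l
  simp
  linear_combination this

end Hypersurface

section Annihilator
variable (K : Type*) [Field K]

theorem det_genericMatrix_ne_zero (n : ℕ) : (genericMatrix K n).det ≠ 0 :=
  Matrix.det_mvPolynomialX_ne_zero (Fin n) K

theorem Fin.eq_succAbove_of_strictMono {m : ℕ} {f : Fin m → Fin (m + 1)} (hf : StrictMono f) :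
    ∃ i : Fin (m + 1), f = i.succAbove := by
  have : ¬ Function.Surjective f := fun h => by
    simpa using Fintype.card_le_of_surjective f h
  obtain ⟨i, hi⟩ := not_forall.1 this
  refine ⟨i, StrictMono.range_inj hf (Fin.strictMono_succAbove i) |>.1 ?_⟩
  refine Set.eq_of_subset_of_ncard_le ?_ ?_
  · rintro _ ⟨a, rfl⟩
    rw [Fin.range_succAbove]
    exact fun h => hi ⟨a, h⟩
  · rw [← Set.image_univ, ← Set.image_univ, Set.ncard_image_of_injective _ hf.injective,
      Set.ncard_image_of_injective _ Fin.succAbove_right_injective]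

theorem det_submatrix_eq_adjugate {A : Type*} [CommRing A] {m : ℕ}
    (M : Matrix (Fin (m + 1)) (Fin (m + 1)) A) (i j : Fin (m + 1)) :
    (M.submatrix j.succAbove i.succAbove).det = (-1) ^ (j + i : ℕ) * M.adjugate i j := by
  rw [Matrix.adjugate_fin_succ_eq_det_submatrix, ← mul_assoc, ← mul_pow]
  simp

theorem exists_comp_eq_det_submatrix_smul {A B : Type*} [CommRing A] [CommRing B] {P : Type*}
    [AddCommGroup P] [Module B P] {m : ℕ} (π : A →+* B)
    (M : Matrix (Fin (m + 1)) (Fin (m + 1)) A) {a b : Fin m → Fin (m + 1)} (ha : StrictMono a)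
    (hb : StrictMono b) (g : (Fin (m + 1) → B) →ₗ[B] P)
    (hg : g ∘ₗ Matrix.mulVecLin (M.adjugate.map π) = 0) :
    ∃ h : (Fin (m + 1) → B) →ₗ[B] P,
      h ∘ₗ Matrix.mulVecLin (M.map π) = π (M.submatrix a b).det • g := by
  obtain ⟨i, rfl⟩ := Fin.eq_succAbove_of_strictMono ha
  obtain ⟨j, rfl⟩ := Fin.eq_succAbove_of_strictMono hb
  obtain ⟨h, hh⟩ := exists_comp_eq_adjugate_smul π M i j g hg
  refine ⟨π ((-1) ^ (i + j : ℕ)) • h, ?_⟩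
  rw [LinearMap.smul_comp, hh, smul_smul, ← map_mul, det_submatrix_eq_adjugate]

theorem exists_comp_eq_smul_of_mem_span {A B : Type*} [CommRing A] [CommRing B] (π : A →+* B)
    {P Q N : Type*} [AddCommGroup P] [Module B P] [AddCommGroup Q] [Module B Q] [AddCommGroup N]
    [Module B N] (φ : P →ₗ[B] Q) (g : P →ₗ[B] N) {t : Set A}
    (ht : ∀ a ∈ t, ∃ h : Q →ₗ[B] N, h ∘ₗ φ = π a • g) {s : A} (hs : s ∈ Ideal.span t) :
    ∃ h : Q →ₗ[B] N, h ∘ₗ φ = π s • g := by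
  refine Submodule.span_induction ht ?_ ?_ ?_ hs
  · exact ⟨0, by rw [LinearMap.zero_comp, map_zero, zero_smul]⟩
  · rintro x y - - ⟨h, hh⟩ ⟨h', hh'⟩
    exact ⟨h + h', by rw [LinearMap.add_comp, hh, hh', map_add, add_smul]⟩
  · rintro a x - ⟨h, hh⟩
    exact ⟨π a • h, by rw [LinearMap.smul_comp, hh, smul_smul, smul_eq_mul, map_mul]⟩

theorem forall_smul_ext_one_eq_zero_iff (m : ℕ) (s : MvPolynomial (Fin (m + 2) × Fin (m + 2)) K) :
    (∀ x : ((Ext (genericDetRing K (m + 2)) (ModuleCat (genericDetRing K (m + 2))) 1).obj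
        (Opposite.op (ModuleCat.of _ ((Fin (m + 2) → genericDetRing K (m + 2)) ⧸
          LinearMap.range (Matrix.mulVecLin (matBar (genericMatrix K (m + 2)))))))).obj
        (ModuleCat.of _ ((Fin (m + 2) → genericDetRing K (m + 2)) ⧸
          LinearMap.range (Matrix.mulVecLin (matBar (genericMatrix K (m + 2))ᵀ)))),
      Ideal.Quotient.mk (Ideal.span {(genericMatrix K (m + 2)).det}) s • x = 0) ↔
      s ∈ minorsIdeal K (m + 2) := by
  have hdet := det_genericMatrix_ne_zero K (m + 2)
  have h₁ := exact_mulVecLin_of_mul_eq_smul_one hdet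
    (genericMatrix K (m + 2)).mul_adjugate (genericMatrix K (m + 2)).adjugate_mul
  have h₂ := exact_mulVecLin_of_mul_eq_smul_one hdet
    (genericMatrix K (m + 2)).adjugate_mul (genericMatrix K (m + 2)).mul_adjugate
  have hext := smul_ext_one_coker_eq_zero_iff _ _ h₁ h₂ ((Fin (m + 2) → genericDetRing K (m + 2)) ⧸
    LinearMap.range (Matrix.mulVecLin (matBar (genericMatrix K (m + 2))ᵀ)))
  refine (hext _).trans ⟨fun hs => ?_, fun hs => ?_⟩
  · let F := FractionRing (MvPolynomial ((Fin (m + 2) × Fin m) ⊕ (Fin m × Fin (m + 2))) K)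
    let α : MvPolynomial ((Fin (m + 2) × Fin m) ⊕ (Fin m × Fin (m + 2))) K →+* F := algebraMap _ F
    obtain ⟨w, w', hw, hw', k, l, hkl⟩ :=
      exists_mulVec_eq_zero_and_ne ((rightFactor K m (m + 2)).map α)
    let σ := α.comp (factorHom K m (m + 2)).toRingHom
    have hσ (v : Fin (m + 2) → F) (hv : (rightFactor K m (m + 2)).map α *ᵥ v = 0) :
        (genericMatrix K (m + 2)).map σ *ᵥ v = 0 := by
      have h : (genericMatrix K (m + 2)).map σ =
          (leftFactor K m (m + 2) * rightFactor K m (m + 2)).map α := by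
        rw [← genericMatrix_map_factorHom]
        rfl
      rw [h, Matrix.map_mul, ← Matrix.mulVec_mulVec, hv, Matrix.mulVec_zero]
    have := map_eq_zero_of_forall_exists_comp_eq_smul hdet hs σ (hσ w hw) (hσ w' hw') hkl
    exact (factorHom_eq_zero_iff K).1 ((map_eq_zero_iff α (IsFractionRing.injective _ F)).1 this)
  · intro g hg
    refine exists_comp_eq_smul_of_mem_span (Ideal.Quotient.mk _) _ g ?_ hs
    rintro _ ⟨a, b, ha, hb, rfl⟩
    exact exists_comp_eq_det_submatrix_smul _ _ ha hb g hg

end Annihilator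

set_option synthInstance.maxHeartbeats 1000000 in
set_option maxHeartbeats 1000000 in
/-- Let `K` be a field, `n ≥ 2`, `R = S/(det X)`, `L = coker(X̄ : Rⁿ → Rⁿ)`
and `L^∨ = coker(X̄ᵀ : Rⁿ → Rⁿ)`.  Then the annihilator of `Ext¹_R(L, L^∨)`, viewed as an
`S`-module by restriction of scalars along `S → R`, is exactly the ideal `I_{n-1}(X) ⊆ S`:
an element `s : S` kills every element of `Ext¹_R(L, L^∨)` iff `s ∈ I_{n-1}(X)`. -/
theorem statement18 (K : Type*) [Field K] (n : ℕ) (hn : 2 ≤ n) :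
    letI R := genericDetRing K n
    letI L := (Fin n → R) ⧸ LinearMap.range (Matrix.mulVecLin (matBar (genericMatrix K n)))
    letI Ldual := (Fin n → R) ⧸ LinearMap.range (Matrix.mulVecLin (matBar (genericMatrix K n)ᵀ))
    letI E := (((Ext R (ModuleCat R) 1).obj
        (Opposite.op (ModuleCat.of R L))).obj (ModuleCat.of R Ldual))
    ∀ s : MvPolynomial (Fin n × Fin n) K,
      (∀ x : E, (Ideal.Quotient.mk (Ideal.span {(genericMatrix K n).det}) s) • x = 0) ↔
        s ∈ minorsIdeal K n := by
  obtain ⟨m, rfl⟩ := Nat.exists_eq_add_of_le' hn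
  exact forall_smul_ext_one_eq_zero_iff K m

end
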